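/- arXiv:2405.13257 — 2 statements merged into one kernel-verified Lean document; each statement's English description precedes it below -/
import Mathlib

section
/- Let φ:(A,d)→(B,d) be a surjective morphism of cdgas in CDGA_r(R) whose homology satisfies condition (★). Then nil ker(H(φ)) ≤ Hsecat(φ) ≤ msecat(φ) ≤ secat(φ). -/
/-!
Common framework: graded differential algebras over a commutative ring `R`,
their cohomology, quasi-isomorphisms, free (product) and free commutative
extensions (relative free models `A ⊔ TV` and relative commutative models
`A ⊗ ΛV`), minimality, H-mildness, and the packages of data used to define
`secat`, `sc` and their variants following Benzaki–Rami.
-/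

namespace MildTC

universe u

/-- A differential on a graded `R`-algebra `A` (graded by `𝒜 : ℕ → Submodule R A`):
an `R`-linear map of degree `1`, squaring to zero and satisfying the graded
Leibniz rule.  Together with the grading this makes `A` a dga over `R`. -/
structure Differential (R : Type u) [CommRing R] {A : Type u} [Ring A] [Algebra R A]
    (𝒜 : ℕ → Submodule R A) : Type u where
  d : A →ₗ[R] A
  d_squared : ∀ a : A, d (d a) = 0
  d_degree : ∀ i : ℕ, ∀ a ∈ 𝒜 i, d a ∈ 𝒜 (i + 1)
  leibniz : ∀ i j : ℕ, ∀ a ∈ 𝒜 i, ∀ b ∈ 𝒜 j,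
    d (a * b) = d a * b + ((-1 : ℤ) ^ i) • (a * d b)

/-- Graded commutativity (the Koszul sign rule): the condition making a graded
algebra a *commutative* graded algebra. -/
def GradedComm {R : Type u} [CommRing R] {A : Type u} [Ring A] [Algebra R A]
    (𝒜 : ℕ → Submodule R A) : Prop :=
  ∀ i j : ℕ, ∀ a ∈ 𝒜 i, ∀ b ∈ 𝒜 j, a * b = ((-1 : ℤ) ^ (i * j)) • (b * a)

section Cohomology

variable {R : Type u} [CommRing R]
variable {A : Type u} [Ring A] [Algebra R A] {𝒜 : ℕ → Submodule R A}
variable {B : Type u} [Ring B] [Algebra R B] {ℬ : ℕ → Submodule R B}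

/-- Cocycles of degree `i`. -/
def cocycles (D : Differential R 𝒜) (i : ℕ) : Submodule R A :=
  𝒜 i ⊓ LinearMap.ker D.d

/-- Coboundaries of degree `i`. -/
def cobounds (D : Differential R 𝒜) (i : ℕ) : Submodule R A :=
  𝒜 i ⊓ LinearMap.range D.d

/-- The degree `i` cohomology `H^i(A,d)` of a dga, as an `R`-module. -/
abbrev cohomology (D : Differential R 𝒜) (i : ℕ) : Type u :=
  ↥(cocycles D i) ⧸ (cobounds D i).comap (cocycles D i).subtype

/-- A morphism of dgas: an algebra morphism preserving degrees and commuting with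
the differentials. -/
structure IsDGAHom (DA : Differential R 𝒜) (DB : Differential R ℬ)
    (f : A →ₐ[R] B) : Prop where
  map_degree : ∀ i : ℕ, ∀ a ∈ 𝒜 i, f a ∈ ℬ i
  comm_d : ∀ a : A, f (DA.d a) = DB.d (f a)

/-- The map `H^i(f)` induced in cohomology by a dga morphism. -/
def inducedH (DA : Differential R 𝒜) (DB : Differential R ℬ) (f : A →ₐ[R] B)
    (hf : IsDGAHom DA DB f) (i : ℕ) :
    cohomology DA i →ₗ[R] cohomology DB i := by
  have hres : ∀ x ∈ cocycles DA i, f.toLinearMap x ∈ cocycles DB i := by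
    intro a ha
    rcases Submodule.mem_inf.1 ha with ⟨h1, h2⟩
    refine Submodule.mem_inf.2 ⟨hf.map_degree i a h1, ?_⟩
    have h2' : DA.d a = 0 := h2
    show DB.d (f a) = 0
    rw [← hf.comm_d a, h2', map_zero]
  refine Submodule.mapQ _ _ (LinearMap.restrict f.toLinearMap hres) ?_
  intro x hx
  simp only [Submodule.mem_comap] at hx ⊢
  rcases Submodule.mem_inf.1 hx with ⟨h1, h2⟩
  rcases h2 with ⟨c, hc⟩
  have hcoe : ((LinearMap.restrict f.toLinearMap hres) x : B) = f (x : A) := rfl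
  refine Submodule.mem_inf.2 ⟨?_, ?_⟩
  · show ((LinearMap.restrict f.toLinearMap hres) x : B) ∈ ℬ i
    rw [hcoe]; exact hf.map_degree i _ h1
  · refine ⟨f c, ?_⟩
    show DB.d (f c) = f (x : A)
    rw [← hf.comm_d c, hc]
    rfl

/-- A quasi-isomorphism of dgas: a dga morphism inducing isomorphisms in cohomology. -/
def IsQuasiIso (DA : Differential R 𝒜) (DB : Differential R ℬ) (f : A →ₐ[R] B)
    (hf : IsDGAHom DA DB f) : Prop :=
  ∀ i : ℕ, Function.Bijective (inducedH DA DB f hf i)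

end Cohomology

/-- A bundled graded differential `R`-algebra. -/
structure GradedDGA (R : Type u) [CommRing R] : Type (u + 1) where
  carrier : Type u
  [ring : Ring carrier]
  [alg : Algebra R carrier]
  grading : ℕ → Submodule R carrier
  [graded : GradedAlgebra grading]
  diff : Differential R grading

attribute [instance] GradedDGA.ring GradedDGA.alg GradedDGA.graded

section Mild

variable {R : Type u} [CommRing R]
variable {A : Type u} [Ring A] [Algebra R A] {𝒜 : ℕ → Submodule R A}

/-- `ρ(R)`: the least prime of `ℕ` that is not invertible in `R` (`∞` if none). -/
noncomputable def rhoPID (R : Type u) [CommRing R] : ℕ∞ :=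
  sInf {q : ℕ∞ | ∃ p : ℕ, q = (p : ℕ∞) ∧ p.Prime ∧ ¬ IsUnit (p : R)}

/-- A dga is `(r,l)`-H-mild when its (reduced) homology is concentrated in
degrees `r+1` through `l` inclusive. -/
def IsHMild (D : Differential R 𝒜) (r : ℕ) (l : ℕ∞) : Prop :=
  ∀ i : ℕ, 1 ≤ i → ¬(r + 1 ≤ i ∧ (i : ℕ∞) ≤ l) → Subsingleton (cohomology D i)

/-- Condition (★): the homology is of finite type, `H^0 = R`, `H^i = 0` for
`1 ≤ i ≤ r` and `H^{r+1}` is `R`-free. -/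
def StarCondition (D : Differential R 𝒜) (r : ℕ) : Prop :=
  (∀ i : ℕ, Module.Finite R (cohomology D i)) ∧
  Nonempty (cohomology D 0 ≃ₗ[R] R) ∧
  (∀ i : ℕ, 1 ≤ i → i ≤ r → Subsingleton (cohomology D i)) ∧
  Module.Free R (cohomology D (r + 1))

end Mild

section FreeExtensions

variable {R : Type u} [CommRing R]
variable {A : Type u} [Ring A] [Algebra R A]
variable {E : Type u} [Ring E] [Algebra R E]

/-- `ι : A → E` together with the graded free submodule family `V` exhibits `E`
as the free product `A ⊔ T(V)` of `A` with the tensor algebra on `V`,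
via the universal property of the coproduct of algebras. -/
def IsFreeProductExtension (ℰ : ℕ → Submodule R E) (ι : A →ₐ[R] E)
    (V : ℕ → Submodule R E) : Prop :=
  (∀ n : ℕ, V n ≤ ℰ n) ∧ (∀ n : ℕ, Module.Free R (V n)) ∧
  ∀ (C : Type u) [Ring C] [Algebra R C],
    ∀ (g : A →ₐ[R] C) (h : ∀ n : ℕ, V n →ₗ[R] C),
    ∃! φ : E →ₐ[R] C, φ.comp ι = g ∧ ∀ (n : ℕ) (v : V n), φ v = h n v

/-- `ι : A → E` together with the graded free submodule family `V` exhibits `E`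
as `A ⊗ ΛV`, the (relative) free commutative extension of `A` on `V`, via the
universal property of the coproduct in the category of graded-commutative
graded `R`-algebras. -/
def IsFreeCommExtension (𝒜 : ℕ → Submodule R A) (ℰ : ℕ → Submodule R E)
    (ι : A →ₐ[R] E) (V : ℕ → Submodule R E) : Prop :=
  (∀ n : ℕ, V n ≤ ℰ n) ∧ (∀ n : ℕ, Module.Free R (V n)) ∧
  ∀ (C : Type u) [Ring C] [Algebra R C] (𝒞 : ℕ → Submodule R C),
    GradedComm 𝒞 →
    ∀ (g : A →ₐ[R] C), (∀ i : ℕ, ∀ a ∈ 𝒜 i, g a ∈ 𝒞 i) →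
    ∀ (h : ∀ n : ℕ, V n →ₗ[R] C), (∀ (n : ℕ) (v : V n), h n v ∈ 𝒞 n) →
    ∃! φ : E →ₐ[R] C, φ.comp ι = g ∧ ∀ (n : ℕ) (v : V n), φ v = h n v

/-- `T` is the free (tensor) graded algebra `T(V)` on the graded free family `V`. -/
def IsFreeAlgebraOn (T : GradedDGA R) (V : ℕ → Submodule R T.carrier) : Prop :=
  (∀ n : ℕ, V n ≤ T.grading n) ∧ (∀ n : ℕ, Module.Free R (V n)) ∧
  ∀ (C : Type u) [Ring C] [Algebra R C],
    ∀ (h : ∀ n : ℕ, V n →ₗ[R] C),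
    ∃! φ : T.carrier →ₐ[R] C, ∀ (n : ℕ) (v : V n), φ v = h n v

/-- `M` is the free graded-commutative algebra `ΛV` on the graded free family `V`. -/
def IsFreeCommAlgebraOn (M : GradedDGA R) (V : ℕ → Submodule R M.carrier) : Prop :=
  (∀ n : ℕ, V n ≤ M.grading n) ∧ (∀ n : ℕ, Module.Free R (V n)) ∧
  ∀ (C : Type u) [Ring C] [Algebra R C] (𝒞 : ℕ → Submodule R C),
    GradedComm 𝒞 →
    ∀ (h : ∀ n : ℕ, V n →ₗ[R] C), (∀ (n : ℕ) (v : V n), h n v ∈ 𝒞 n) →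
    ∃! φ : M.carrier →ₐ[R] C, ∀ (n : ℕ) (v : V n), φ v = h n v

end FreeExtensions

section Minimality

variable {R : Type u} [CommRing R]
variable {A : Type u} [Ring A] [Algebra R A] {𝒜 : ℕ → Submodule R A}

/-- The differential is decomposable on the generating family `V`:
`d(V) ⊆ (span V)·(span V)` (i.e. `d(V) ⊆ T^{≥2}V`, resp. `Λ^{≥2}V`). -/
def IsDecomposable (D : Differential R 𝒜) (V : ℕ → Submodule R A) : Prop :=
  ∀ n : ℕ, ∀ v ∈ V n,
    D.d v ∈ (Submodule.span R (⋃ k, (V k : Set A))) * (Submodule.span R (⋃ k, (V k : Set A)))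

/-- Minimality of a (relative) free dga with generating family `V`:
decomposability of the differential when `R` is a field, and in general, for
every degree `i` there is a non-invertible `r_i ∈ R` with `d(V^i) ⊆ r_i·(degree i+1 part)`. -/
def IsMinimal (D : Differential R 𝒜) (V : ℕ → Submodule R A) : Prop :=
  (IsField R → IsDecomposable D V) ∧
  (¬ IsField R → ∀ i : ℕ, ∃ r : R, ¬ IsUnit r ∧
    ∀ v ∈ V i, ∃ w ∈ 𝒜 (i + 1), D.d v = r • w)

end Minimality

section TensorPower

variable {R : Type u} [CommRing R]
variable {A : Type u} [Ring A] [Algebra R A] {𝒜 : ℕ → Submodule R A}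

/-- `T`, with the `m` inclusions `incl j : A → T`, is the `m`-fold tensor power
`A^{⊗m}` of the commutative dga `A`: the `m`-fold coproduct of `A` in the
category of graded-commutative dgas. -/
def IsTensorPower (DA : Differential R 𝒜) (m : ℕ) (T : GradedDGA R)
    (incl : Fin m → (A →ₐ[R] T.carrier)) : Prop :=
  GradedComm T.grading ∧ (∀ j, IsDGAHom DA T.diff (incl j)) ∧
  ∀ (C : Type u) [Ring C] [Algebra R C] (𝒞 : ℕ → Submodule R C),
    GradedComm 𝒞 →
    ∀ (g : Fin m → (A →ₐ[R] C)), (∀ j, ∀ i : ℕ, ∀ a ∈ 𝒜 i, g j a ∈ 𝒞 i) →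
    ∃! h : T.carrier →ₐ[R] C, ∀ j, h.comp (incl j) = g j

/-- `T`, with the `m` inclusions `incl j : A → T`, is the `m`-fold (graded)
tensor power `A^{⊗m}` of the dga `A` (not necessarily commutative), via the
universal property of the graded tensor product of graded algebras. -/
def IsTensorPowerNC (DA : Differential R 𝒜) (m : ℕ) (T : GradedDGA R)
    (incl : Fin m → (A →ₐ[R] T.carrier)) : Prop :=
  (∀ j, IsDGAHom DA T.diff (incl j)) ∧
  (∀ j k : Fin m, j ≠ k → ∀ p q : ℕ, ∀ a ∈ 𝒜 p, ∀ b ∈ 𝒜 q,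
    incl k b * incl j a = ((-1 : ℤ) ^ (p * q)) • (incl j a * incl k b)) ∧
  ∀ (C : Type u) [Ring C] [Algebra R C] (𝒞 : ℕ → Submodule R C),
    ∀ (g : Fin m → (A →ₐ[R] C)), (∀ j, ∀ i : ℕ, ∀ a ∈ 𝒜 i, g j a ∈ 𝒞 i) →
    (∀ j k : Fin m, j ≠ k → ∀ p q : ℕ, ∀ a ∈ 𝒜 p, ∀ b ∈ 𝒜 q,
      g k b * g j a = ((-1 : ℤ) ^ (p * q)) • (g j a * g k b)) →
    ∃! h : T.carrier →ₐ[R] C, ∀ j, h.comp (incl j) = g j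

end TensorPower

/-- `sInf` of a set of natural numbers, viewed in `ℕ∞` (`⊤` if empty). -/
noncomputable def leastNat (P : ℕ → Prop) : ℕ∞ :=
  sInf {N : ℕ∞ | ∃ m : ℕ, N = (m : ℕ∞) ∧ P m}

/-- `sSup` of a set of natural numbers, viewed in `ℕ∞`. -/
noncomputable def greatestNat (P : ℕ → Prop) : ℕ∞ :=
  sSup {N : ℕ∞ | ∃ m : ℕ, N = (m : ℕ∞) ∧ P m}

section Nilpotency

variable {R : Type u} [CommRing R]
variable {A : Type u} [Ring A] [Algebra R A] {𝒜 : ℕ → Submodule R A}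
variable {B : Type u} [Ring B] [Algebra R B] {ℬ : ℕ → Submodule R B}

/-- `nil ker(H(φ))`: the length of the longest non-trivial product of elements
of `ker H(φ)`, expressed via homogeneous cocycle representatives. -/
noncomputable def nilKerH (DA : Differential R 𝒜) (DB : Differential R ℬ)
    (φ : A →ₐ[R] B) : ℕ∞ :=
  greatestNat (fun k =>
    ∃ (n : Fin k → ℕ) (a : Fin k → A),
      (∀ i, a i ∈ cocycles DA (n i)) ∧
      (∀ i, φ (a i) ∈ LinearMap.range DB.d) ∧
      (List.ofFn a).prod ∉ LinearMap.range DA.d)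

/-- `nil ker(φ)`: the length of the longest non-trivial product of elements of
the ideal `ker φ`. -/
noncomputable def nilKerAlg (φ : A →ₐ[R] B) : ℕ∞ :=
  greatestNat (fun k =>
    ∃ a : Fin k → A, (∀ i, φ (a i) = 0) ∧ (List.ofFn a).prod ≠ 0)

/-- An acyclic (two-sided, differential) ideal of a dga. -/
def IsAcyclicIdeal (D : Differential R 𝒜) (J : Submodule R A) : Prop :=
  (∀ x ∈ J, ∀ a : A, a * x ∈ J ∧ x * a ∈ J) ∧
  (∀ x ∈ J, D.d x ∈ J) ∧
  (∀ x ∈ J, D.d x = 0 → ∃ y ∈ J, D.d y = x)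

/-- The homology nilpotency `Hnil I` of an ideal `I`: the least `k` such that
`I^{k+1}` is contained in some acyclic ideal of `A`. -/
noncomputable def Hnil (D : Differential R 𝒜) (I : Submodule R A) : ℕ∞ :=
  leastNat (fun k => ∃ J : Submodule R A, IsAcyclicIdeal D J ∧ I ^ (k + 1) ≤ J)

end Nilpotency

section Packages

variable {R : Type u} [CommRing R]
variable {A : Type u} [Ring A] [Algebra R A] {𝒜 : ℕ → Submodule R A}
variable {B : Type u} [Ring B] [Algebra R B] {ℬ : ℕ → Submodule R B}

/-- All the data entering the definition of the sectional category `secat(φ)` of a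
surjective morphism `φ : (A,d) → (B,d)` of cdgas: the tensor power
`T = A^{⊗(m+1)}`, the `(m+1)`-fold multiplication `μ_{m+1}`, the projection
`p_m : A^{⊗(m+1)} → A^{⊗(m+1)}/(ker φ)^{⊗(m+1)}`, a commutative model
`i_m : A^{⊗(m+1)} ↪ A^{⊗(m+1)} ⊗ ΛW_{(m)}` of `p_m`, and the pushout
`j_m : A ↪ A ⊗ ΛW_{(m)}` of `i_m` along `μ_{m+1}`. -/
structure SecatPackage (DA : Differential R 𝒜) (DB : Differential R ℬ)
    (φ : A →ₐ[R] B) (m : ℕ) : Type (u + 1) where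
  /-- the tensor power `A^{⊗(m+1)}` -/
  T : GradedDGA R
  incl : Fin (m + 1) → (A →ₐ[R] T.carrier)
  T_power : IsTensorPower DA (m + 1) T incl
  /-- the `(m+1)`-fold multiplication `μ_{m+1} : A^{⊗(m+1)} → A` -/
  mul : T.carrier →ₐ[R] A
  mul_dga : IsDGAHom T.diff DA mul
  mul_incl : ∀ j, mul.comp (incl j) = AlgHom.id R A
  /-- the quotient `A^{⊗(m+1)}/(ker φ)^{⊗(m+1)}` -/
  Q : GradedDGA R
  Qcomm : GradedComm Q.grading
  p : T.carrier →ₐ[R] Q.carrier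
  p_dga : IsDGAHom T.diff Q.diff p
  p_surj : Function.Surjective p
  p_ker : LinearMap.ker p.toLinearMap =
    (List.ofFn fun j : Fin (m + 1) =>
      Submodule.map (incl j).toLinearMap (LinearMap.ker φ.toLinearMap)).prod
  /-- a commutative model `i_m` of `p_m`, with generating graded module `W_{(m)}` -/
  E : GradedDGA R
  Ecomm : GradedComm E.grading
  i : T.carrier →ₐ[R] E.carrier
  i_dga : IsDGAHom T.diff E.diff i
  W : ℕ → Submodule R E.carrier
  i_free : IsFreeCommExtension T.grading E.grading i W
  ψ : E.carrier →ₐ[R] Q.carrier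
  ψ_dga : IsDGAHom E.diff Q.diff ψ
  ψ_qiso : IsQuasiIso E.diff Q.diff ψ ψ_dga
  ψ_i : ψ.comp i = p
  /-- the pushout `A ⊗ ΛW_{(m)}` of `i_m` along `μ_{m+1}`, with inclusion `j_m` -/
  F : GradedDGA R
  Fcomm : GradedComm F.grading
  j : A →ₐ[R] F.carrier
  j_dga : IsDGAHom DA F.diff j
  bar : E.carrier →ₐ[R] F.carrier
  bar_dga : IsDGAHom E.diff F.diff bar
  square : bar.comp i = j.comp mul
  pushout : ∀ (C : GradedDGA R), GradedComm C.grading →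
    ∀ (τ : E.carrier →ₐ[R] C.carrier), IsDGAHom E.diff C.diff τ →
    ∀ (g : A →ₐ[R] C.carrier), IsDGAHom DA C.diff g →
    τ.comp i = g.comp mul →
    ∃! h : F.carrier →ₐ[R] C.carrier, h.comp bar = τ ∧ h.comp j = g

/-- `secat(φ)`: the least `m` such that `j_m` admits a cdga retraction. -/
noncomputable def secat {DA : Differential R 𝒜} {DB : Differential R ℬ}
    {φ : A →ₐ[R] B} (S : ∀ m : ℕ, SecatPackage DA DB φ m) : ℕ∞ :=
  leastNat (fun m => ∃ ret : (S m).F.carrier →ₐ[R] A,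
    IsDGAHom (S m).F.diff DA ret ∧ ret.comp (S m).j = AlgHom.id R A)

/-- `msecat(φ)`: the least `m` such that `j_m` admits an `A`-(dg-)module retraction. -/
noncomputable def msecat {DA : Differential R 𝒜} {DB : Differential R ℬ}
    {φ : A →ₐ[R] B} (S : ∀ m : ℕ, SecatPackage DA DB φ m) : ℕ∞ :=
  leastNat (fun m => ∃ ret : (S m).F.carrier →ₗ[R] A,
    (∀ i : ℕ, ∀ x ∈ (S m).F.grading i, ret x ∈ 𝒜 i) ∧
    (∀ x, ret ((S m).F.diff.d x) = DA.d (ret x)) ∧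
    (∀ (a : A) (x : (S m).F.carrier), ret ((S m).j a * x) = a * ret x) ∧
    (∀ a : A, ret ((S m).j a) = a))

/-- `Hsecat(φ)`: the least `m` such that `H(j_m)` is injective. -/
noncomputable def Hsecat {DA : Differential R 𝒜} {DB : Differential R ℬ}
    {φ : A →ₐ[R] B} (S : ∀ m : ℕ, SecatPackage DA DB φ m) : ℕ∞ :=
  leastNat (fun m => ∀ i : ℕ,
    Function.Injective (inducedH DA (S m).F.diff (S m).j (S m).j_dga i))

/-- All the data entering the definition of `sc(φ)` for a surjective morphism
`φ : (A,d) → (B,d)` of cdgas: the projection `Γ_m : A → A/(ker φ)^{m+1}` and a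
commutative model `ι_m : A ↪ A ⊗ ΛV_{(m)}` of `Γ_m`. -/
structure ScPackage (DA : Differential R 𝒜) (DB : Differential R ℬ)
    (φ : A →ₐ[R] B) (m : ℕ) : Type (u + 1) where
  /-- the quotient `A/(ker φ)^{m+1}` -/
  Q : GradedDGA R
  Qcomm : GradedComm Q.grading
  Γ : A →ₐ[R] Q.carrier
  Γ_dga : IsDGAHom DA Q.diff Γ
  Γ_surj : Function.Surjective Γ
  Γ_ker : LinearMap.ker Γ.toLinearMap = (LinearMap.ker φ.toLinearMap) ^ (m + 1)
  /-- a commutative model `ι_m : A ↪ A ⊗ ΛV_{(m)}` of `Γ_m` -/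
  G : GradedDGA R
  Gcomm : GradedComm G.grading
  ι : A →ₐ[R] G.carrier
  ι_dga : IsDGAHom DA G.diff ι
  V : ℕ → Submodule R G.carrier
  ι_free : IsFreeCommExtension 𝒜 G.grading ι V
  ψ : G.carrier →ₐ[R] Q.carrier
  ψ_dga : IsDGAHom G.diff Q.diff ψ
  ψ_qiso : IsQuasiIso G.diff Q.diff ψ ψ_dga
  ψ_ι : ψ.comp ι = Γ

/-- `sc(φ)`: the least `m` such that `ι_m` admits a cdga (homotopy) retraction. -/
noncomputable def sc {DA : Differential R 𝒜} {DB : Differential R ℬ}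
    {φ : A →ₐ[R] B} (P : ∀ m : ℕ, ScPackage DA DB φ m) : ℕ∞ :=
  leastNat (fun m => ∃ ret : (P m).G.carrier →ₐ[R] A,
    IsDGAHom (P m).G.diff DA ret ∧ ret.comp (P m).ι = AlgHom.id R A)

/-- `msc(φ)`: the least `m` such that `ι_m` admits an `A`-(dg-)module retraction. -/
noncomputable def msc {DA : Differential R 𝒜} {DB : Differential R ℬ}
    {φ : A →ₐ[R] B} (P : ∀ m : ℕ, ScPackage DA DB φ m) : ℕ∞ :=
  leastNat (fun m => ∃ ret : (P m).G.carrier →ₗ[R] A,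
    (∀ i : ℕ, ∀ x ∈ (P m).G.grading i, ret x ∈ 𝒜 i) ∧
    (∀ x, ret ((P m).G.diff.d x) = DA.d (ret x)) ∧
    (∀ (a : A) (x : (P m).G.carrier), ret ((P m).ι a * x) = a * ret x) ∧
    (∀ a : A, ret ((P m).ι a) = a))

/-- `Hsc(φ)`: the least `m` such that `H(Γ_m)` is injective. -/
noncomputable def Hsc {DA : Differential R 𝒜} {DB : Differential R ℬ}
    {φ : A →ₐ[R] B} (P : ∀ m : ℕ, ScPackage DA DB φ m) : ℕ∞ :=
  leastNat (fun m => ∀ i : ℕ,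
    Function.Injective (inducedH DA (P m).Q.diff (P m).Γ (P m).Γ_dga i))

/-- The analogue of `SecatPackage` in the category of (not necessarily
commutative) dgas: free models `A^{⊗(m+1)} ⊔ TW_{(m)}` (free products with
tensor algebras) replace commutative models. -/
structure ASecatPackage (DA : Differential R 𝒜) (DB : Differential R ℬ)
    (φ : A →ₐ[R] B) (m : ℕ) : Type (u + 1) where
  T : GradedDGA R
  incl : Fin (m + 1) → (A →ₐ[R] T.carrier)
  T_power : IsTensorPowerNC DA (m + 1) T incl
  mul : T.carrier →ₐ[R] A
  mul_dga : IsDGAHom T.diff DA mul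
  mul_incl : ∀ j, mul.comp (incl j) = AlgHom.id R A
  Q : GradedDGA R
  p : T.carrier →ₐ[R] Q.carrier
  p_dga : IsDGAHom T.diff Q.diff p
  p_surj : Function.Surjective p
  p_ker : LinearMap.ker p.toLinearMap =
    (List.ofFn fun j : Fin (m + 1) =>
      Submodule.map (incl j).toLinearMap (LinearMap.ker φ.toLinearMap)).prod
  /-- a free model `i_m : A^{⊗(m+1)} ↪ A^{⊗(m+1)} ⊔ TW_{(m)}` of `p_m` -/
  E : GradedDGA R
  i : T.carrier →ₐ[R] E.carrier
  i_dga : IsDGAHom T.diff E.diff i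
  W : ℕ → Submodule R E.carrier
  i_free : IsFreeProductExtension E.grading i W
  ψ : E.carrier →ₐ[R] Q.carrier
  ψ_dga : IsDGAHom E.diff Q.diff ψ
  ψ_qiso : IsQuasiIso E.diff Q.diff ψ ψ_dga
  ψ_i : ψ.comp i = p
  /-- the pushout `A ⊔ TW_{(m)}` of `i_m` along `μ_{m+1}`, with inclusion `j_m` -/
  F : GradedDGA R
  j : A →ₐ[R] F.carrier
  j_dga : IsDGAHom DA F.diff j
  bar : E.carrier →ₐ[R] F.carrier
  bar_dga : IsDGAHom E.diff F.diff bar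
  square : bar.comp i = j.comp mul
  pushout : ∀ (C : GradedDGA R),
    ∀ (τ : E.carrier →ₐ[R] C.carrier), IsDGAHom E.diff C.diff τ →
    ∀ (g : A →ₐ[R] C.carrier), IsDGAHom DA C.diff g →
    τ.comp i = g.comp mul →
    ∃! h : F.carrier →ₐ[R] C.carrier, h.comp bar = τ ∧ h.comp j = g

/-- `Asecat(φ)`: the least `m` such that `j_m` admits a dga retraction,
equivalently such that there is a dga morphism `τ` with `τ ∘ i_m = μ_{m+1}`. -/
noncomputable def Asecat {DA : Differential R 𝒜} {DB : Differential R ℬ}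
    {φ : A →ₐ[R] B} (S : ∀ m : ℕ, ASecatPackage DA DB φ m) : ℕ∞ :=
  leastNat (fun m => ∃ ret : (S m).F.carrier →ₐ[R] A,
    IsDGAHom (S m).F.diff DA ret ∧ ret.comp (S m).j = AlgHom.id R A)

/-- The analogue of `ScPackage` in the category of dgas: a free model
`ι_m : A ↪ A ⊔ TV_{(m)}` of the projection `Γ_m : A → A/(ker φ)^{m+1}`. -/
structure AScPackage (DA : Differential R 𝒜) (DB : Differential R ℬ)
    (φ : A →ₐ[R] B) (m : ℕ) : Type (u + 1) where
  Q : GradedDGA R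
  Γ : A →ₐ[R] Q.carrier
  Γ_dga : IsDGAHom DA Q.diff Γ
  Γ_surj : Function.Surjective Γ
  Γ_ker : LinearMap.ker Γ.toLinearMap = (LinearMap.ker φ.toLinearMap) ^ (m + 1)
  G : GradedDGA R
  ι : A →ₐ[R] G.carrier
  ι_dga : IsDGAHom DA G.diff ι
  V : ℕ → Submodule R G.carrier
  ι_free : IsFreeProductExtension G.grading ι V
  ψ : G.carrier →ₐ[R] Q.carrier
  ψ_dga : IsDGAHom G.diff Q.diff ψ
  ψ_qiso : IsQuasiIso G.diff Q.diff ψ ψ_dga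
  ψ_ι : ψ.comp ι = Γ

/-- `Asc(φ)`: the least `m` such that `Γ_m` admits a homotopy retraction, i.e.
`ι_m` admits a dga retraction. -/
noncomputable def Asc {DA : Differential R 𝒜} {DB : Differential R ℬ}
    {φ : A →ₐ[R] B} (P : ∀ m : ℕ, AScPackage DA DB φ m) : ℕ∞ :=
  leastNat (fun m => ∃ ret : (P m).G.carrier →ₐ[R] A,
    IsDGAHom (P m).G.diff DA ret ∧ ret.comp (P m).ι = AlgHom.id R A)

end Packages

section Spaces

variable (R : Type u) [CommRing R]

/-- Abstract packaging of a finite-type `(r,ρ(R))`-mild CW-complex `X` with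
`H_*(ΩX;R)` torsion free, together with its (designated) cochain algebra
`C = C^*(X;R)` and its decomposable minimal commutative model `(ΛV,d)`
(the commutative model of the Chevalley–Eilenberg complex `C^*(L)` of its
Anick–Halperin Lie model `L`). -/
structure MildSpaceModel (r : ℕ) : Type (u + 1) where
  /-- the underlying space -/
  X : Type u
  [topX : TopologicalSpace X]
  x₀ : X
  [pconn : PathConnectedSpace X]
  /-- `X` is `r`-connected -/
  rconn : ∀ k : ℕ, 1 ≤ k → k ≤ r → Subsingleton (HomotopyGroup (Fin k) X x₀)
  /-- the loop-space homology `H_n(ΩX;R)` -/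
  LH : ℕ → Type u
  [lhAdd : ∀ n, AddCommGroup (LH n)]
  [lhMod : ∀ n, Module R (LH n)]
  /-- `H_*(ΩX;R)` is of finite type -/
  lhFinite : ∀ n, Module.Finite R (LH n)
  /-- `H_*(ΩX;R)` is torsion free -/
  lhTorsionFree : ∀ n, NoZeroSMulDivisors R (LH n)
  /-- the cochain algebra `C^*(X;R)` (finite type, `r`-connected, of dimension
  `≤ rρ(R)`; this is the `(r,ρ(R))`-mildness of `X`) -/
  C : GradedDGA R
  C_mild : IsHMild C.diff r ((r : ℕ∞) * rhoPID R)
  C_star : StarCondition C.diff r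
  /-- the decomposable minimal commutative model `(ΛV,d)` of `X` -/
  M : GradedDGA R
  Mcomm : GradedComm M.grading
  V : ℕ → Submodule R M.carrier
  Vfin : ∀ n, Module.Finite R (V n)
  M_free : IsFreeCommAlgebraOn M V
  M_min : IsMinimal M.diff V
  M_dec : IsDecomposable M.diff V
  M_mild : IsHMild M.diff r ((r : ℕ∞) * rhoPID R)
  /-- the model computes the cohomology of `X` -/
  M_matches : ∀ n : ℕ, Nonempty (cohomology M.diff n ≃ₗ[R] cohomology C.diff n)

attribute [instance] MildSpaceModel.topX MildSpaceModel.pconn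
  MildSpaceModel.lhAdd MildSpaceModel.lhMod

/-- Abstract packaging of a `1`-connected space `X` of `R`-finite type together
with its (designated) cochain algebra `C = C^*(X;R)` and loop-space homology. -/
structure SimplyConnectedSpaceData : Type (u + 1) where
  X : Type u
  [topX : TopologicalSpace X]
  x₀ : X
  [pconn : PathConnectedSpace X]
  [sconn : SimplyConnectedSpace X]
  /-- the loop-space homology `H_n(ΩX;R)` -/
  LH : ℕ → Type u
  [lhAdd : ∀ n, AddCommGroup (LH n)]
  [lhMod : ∀ n, Module R (LH n)]
  /-- the cochain algebra `C^*(X;R)` -/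
  C : GradedDGA R
  /-- `H^0(X;R) = R` -/
  H0 : Nonempty (cohomology C.diff 0 ≃ₗ[R] R)
  /-- `H^1(X;R) = 0` -/
  H1 : Subsingleton (cohomology C.diff 1)
  /-- each `H^i(X;R)` is a finite type `R`-module -/
  Hfg : ∀ i : ℕ, Module.Finite R (cohomology C.diff i)

attribute [instance] SimplyConnectedSpaceData.topX SimplyConnectedSpaceData.pconn
  SimplyConnectedSpaceData.sconn SimplyConnectedSpaceData.lhAdd
  SimplyConnectedSpaceData.lhMod

end Spaces


section CohomologyClasses

variable {R : Type u} [CommRing R]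
variable {A : Type u} [Ring A] [Algebra R A] {𝒜 : ℕ → Submodule R A}
variable {B : Type u} [Ring B] [Algebra R B] {ℬ : ℕ → Submodule R B}

theorem IsDGAHom.map_cocycles {DA : Differential R 𝒜} {DB : Differential R ℬ} {f : A →ₐ[R] B}
    (hf : IsDGAHom DA DB f) {i : ℕ} {x : A} (hx : x ∈ cocycles DA i) : f x ∈ cocycles DB i := by
  refine ⟨hf.map_degree i x hx.1, ?_⟩
  have h : DA.d x = 0 := hx.2
  change DB.d (f x) = 0
  rw [← hf.comm_d, h, map_zero]

theorem IsDGAHom.map_range {DA : Differential R 𝒜} {DB : Differential R ℬ} {f : A →ₐ[R] B}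
    (hf : IsDGAHom DA DB f) {x : A} (hx : x ∈ LinearMap.range DA.d) :
    f x ∈ LinearMap.range DB.d := by
  obtain ⟨c, rfl⟩ := hx
  exact ⟨f c, (hf.comm_d c).symm⟩

theorem inducedH_injective_iff {DA : Differential R 𝒜} {DB : Differential R ℬ} {f : A →ₐ[R] B}
    (hf : IsDGAHom DA DB f) (i : ℕ) :
    Function.Injective (inducedH DA DB f hf i) ↔
      ∀ x ∈ cocycles DA i, f x ∈ LinearMap.range DB.d → x ∈ LinearMap.range DA.d := by
  rw [injective_iff_map_eq_zero]
  constructor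
  · intro h x hx hfx
    have h0 := h (Submodule.Quotient.mk ⟨x, hx⟩) ((Submodule.Quotient.mk_eq_zero _).2
      ⟨hf.map_degree i x hx.1, hfx⟩)
    exact ((Submodule.Quotient.mk_eq_zero _).1 h0).2
  · intro h q hq
    induction q using Submodule.Quotient.induction_on with
    | _ x =>
      have hfx := ((Submodule.Quotient.mk_eq_zero _).1 hq).2
      exact (Submodule.Quotient.mk_eq_zero _).2 ⟨x.2.1, h x x.2 hfx⟩

theorem Differential.leibniz_left [GradedAlgebra 𝒜] (D : Differential R 𝒜) {i : ℕ} {a : A}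
    (ha : a ∈ 𝒜 i) (b : A) : D.d (a * b) = D.d a * b + ((-1 : ℤ) ^ i) • (a * D.d b) := by
  induction b using DirectSum.Decomposition.inductionOn 𝒜 with
  | zero => simp
  | homogeneous b => exact D.leibniz i _ a ha b b.2
  | add b c hb hc => rw [mul_add, map_add, hb, hc, map_add, mul_add, mul_add, smul_add]; abel

theorem mul_mem_cocycles [GradedAlgebra 𝒜] (D : Differential R 𝒜) {i j : ℕ} {x y : A}
    (hx : x ∈ cocycles D i) (hy : y ∈ cocycles D j) : x * y ∈ cocycles D (i + j) := by
  have hdx : D.d x = 0 := hx.2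
  have hdy : D.d y = 0 := hy.2
  refine ⟨SetLike.mul_mem_graded hx.1 hy.1, ?_⟩
  change D.d (x * y) = 0
  rw [D.leibniz i j x hx.1 y hy.1, hdx, hdy]
  simp

theorem one_mem_cocycles [GradedAlgebra 𝒜] (D : Differential R 𝒜) :
    (1 : A) ∈ cocycles D 0 := by
  have h1 : (1 : A) ∈ 𝒜 0 := SetLike.one_mem_graded 𝒜
  refine ⟨h1, ?_⟩
  have h := D.leibniz 0 0 1 h1 1 h1
  change D.d 1 = 0
  simpa using h

theorem prod_ofFn_mem_cocycles [GradedAlgebra 𝒜] (D : Differential R 𝒜) {k : ℕ}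
    {n : Fin k → ℕ} {a : Fin k → A} (ha : ∀ i, a i ∈ cocycles D (n i)) :
    (List.ofFn a).prod ∈ cocycles D (List.ofFn n).sum := by
  induction k with
  | zero => simpa using one_mem_cocycles D
  | succ k ih =>
    rw [List.ofFn_succ, List.ofFn_succ, List.prod_cons, List.sum_cons]
    exact mul_mem_cocycles D (ha 0) (ih fun i => ha i.succ)

theorem mul_mem_range_of_left [GradedAlgebra 𝒜] (D : Differential R 𝒜) {j : ℕ} {x y : A}
    (hx : x ∈ LinearMap.range D.d) (hy : y ∈ cocycles D j) : x * y ∈ LinearMap.range D.d := by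
  obtain ⟨c, rfl⟩ := hx
  have hdy : D.d y = 0 := hy.2
  refine ⟨c * y, ?_⟩
  induction c using DirectSum.Decomposition.inductionOn 𝒜 with
  | zero => simp
  | homogeneous c => rw [D.leibniz_left c.2, hdy]; simp
  | add b c hb hc => rw [add_mul, map_add, hb, hc, map_add, add_mul]

theorem mul_mem_range_of_right [GradedAlgebra 𝒜] (D : Differential R 𝒜) {i : ℕ} {x y : A}
    (hx : x ∈ cocycles D i) (hy : y ∈ LinearMap.range D.d) : x * y ∈ LinearMap.range D.d := by
  obtain ⟨c, rfl⟩ := hy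
  have hdx : D.d x = 0 := hx.2
  refine ⟨((-1 : ℤ) ^ i) • (x * c), ?_⟩
  rw [map_zsmul, D.leibniz_left hx.1, hdx, zero_mul, zero_add, smul_smul, ← mul_pow]
  simp

theorem prod_ofFn_sub_prod_ofFn_mem_range [GradedAlgebra 𝒜] (D : Differential R 𝒜) {k : ℕ}
    {n : Fin k → ℕ} {a b : Fin k → A} (ha : ∀ i, a i ∈ cocycles D (n i))
    (hb : ∀ i, b i ∈ cocycles D (n i)) (hab : ∀ i, a i - b i ∈ LinearMap.range D.d) :
    (List.ofFn a).prod - (List.ofFn b).prod ∈ LinearMap.range D.d := by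
  induction k with
  | zero => simp
  | succ k ih =>
    rw [List.ofFn_succ, List.ofFn_succ, List.prod_cons, List.prod_cons]
    have h1 := mul_mem_range_of_left D (hab 0) (prod_ofFn_mem_cocycles D fun i => ha i.succ)
    have h2 := mul_mem_range_of_right D (hb 0)
      (ih (fun i => ha i.succ) (fun i => hb i.succ) fun i => hab i.succ)
    convert Submodule.add_mem _ h1 h2 using 1
    noncomm_ring

/-- A linear map shifting degrees along an injective `e` commutes with homogeneous components. -/
theorem decompose_map_apply [GradedAlgebra 𝒜] [GradedAlgebra ℬ] (f : A →ₗ[R] B) {e : ℕ → ℕ}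
    (he : Function.Injective e) (hf : ∀ i, ∀ a ∈ 𝒜 i, f a ∈ ℬ (e i)) (x : A) (i : ℕ) :
    (DirectSum.decompose ℬ (f x) (e i) : B) = f (DirectSum.decompose 𝒜 x i) := by
  induction x using DirectSum.Decomposition.inductionOn 𝒜 with
  | zero => simp
  | @homogeneous j x =>
    by_cases hij : j = i
    · subst hij
      rw [DirectSum.decompose_of_mem_same ℬ (hf j x x.2), DirectSum.decompose_of_mem_same 𝒜 x.2]
    · rw [DirectSum.decompose_of_mem_ne ℬ (hf j x x.2) fun h => hij (he h),
        DirectSum.decompose_of_mem_ne 𝒜 x.2 hij, map_zero]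
  | add x y hx hy =>
    simp only [map_add, DirectSum.decompose_add, DirectSum.add_apply, Submodule.coe_add, hx, hy]

theorem decompose_d_zero [GradedAlgebra 𝒜] (D : Differential R 𝒜) (x : A) :
    (DirectSum.decompose 𝒜 (D.d x) 0 : A) = 0 := by
  induction x using DirectSum.Decomposition.inductionOn 𝒜 with
  | zero => simp
  | @homogeneous j x =>
    exact DirectSum.decompose_of_mem_ne 𝒜 (D.d_degree j x x.2) (Nat.succ_ne_zero j)
  | add x y hx hy =>
    simp only [map_add, DirectSum.decompose_add, DirectSum.add_apply, Submodule.coe_add, hx, hy,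
      add_zero]

/-- A cohomology class in the kernel of `H(φ)`, for `φ` surjective, has a representative in
the kernel of `φ`. -/
theorem exists_cocycle_mem_ker [GradedAlgebra 𝒜] [GradedAlgebra ℬ] {DA : Differential R 𝒜}
    {DB : Differential R ℬ} {φ : A →ₐ[R] B} (hφ : IsDGAHom DA DB φ)
    (hsurj : Function.Surjective φ) {n : ℕ} {a : A} (ha : a ∈ cocycles DA n)
    (hφa : φ a ∈ LinearMap.range DB.d) :
    ∃ b ∈ cocycles DA n, φ b = 0 ∧ a - b ∈ LinearMap.range DA.d := by
  obtain ⟨β, hβ⟩ := hφa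
  have hdeg : φ a ∈ ℬ n := hφ.map_degree n a ha.1
  cases n with
  | zero =>
    refine ⟨a, ha, ?_, by simp⟩
    rw [← DirectSum.decompose_of_mem_same ℬ hdeg, ← hβ, decompose_d_zero]
  | succ n =>
    obtain ⟨c, rfl⟩ := hsurj β
    let c' : A := ↑(DirectSum.decompose 𝒜 c n)
    have hc'deg : c' ∈ 𝒜 n := SetLike.coe_mem _
    have hφc : φ (DA.d c') = φ a := by
      rw [hφ.comm_d, ← DirectSum.decompose_of_mem_same ℬ hdeg, ← hβ,
        decompose_map_apply DB.d (add_left_injective 1) DB.d_degree]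
      congr 1
      exact (decompose_map_apply φ.toLinearMap Function.injective_id hφ.map_degree c n).symm
    refine ⟨a - DA.d c', ?_, by rw [map_sub, hφc, sub_self], c', by abel⟩
    exact Submodule.sub_mem _ ha ⟨DA.d_degree n c' hc'deg, DA.d_squared c'⟩

theorem prod_ofFn_mem_prod_ofFn {k : ℕ} {M : Fin k → Submodule R A} {a : Fin k → A}
    (ha : ∀ i, a i ∈ M i) : (List.ofFn a).prod ∈ (List.ofFn M).prod := by
  induction k with
  | zero => simpa using Submodule.one_le.1 (le_refl (1 : Submodule R A))
  | succ k ih =>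
    rw [List.ofFn_succ, List.ofFn_succ, List.prod_cons, List.prod_cons]
    exact Submodule.mul_mem_mul (ha 0) (ih fun i => ha i.succ)

end CohomologyClasses

section SectionalCategory

variable {R : Type u} [CommRing R]
variable {A : Type u} [Ring A] [Algebra R A] {𝒜 : ℕ → Submodule R A}
variable {B : Type u} [Ring B] [Algebra R B] {ℬ : ℕ → Submodule R B}
variable {DA : Differential R 𝒜} {DB : Differential R ℬ} {φ : A →ₐ[R] B}

theorem leastNat_le_leastNat {P Q : ℕ → Prop} (h : ∀ m, Q m → P m) : leastNat P ≤ leastNat Q :=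
  sInf_le_sInf fun _ ⟨m, hm, hQ⟩ => ⟨m, hm, h m hQ⟩

theorem greatestNat_le_leastNat {P Q : ℕ → Prop} (h : ∀ k m, P k → Q m → k ≤ m) :
    greatestNat P ≤ leastNat Q := by
  refine sSup_le ?_
  rintro _ ⟨k, rfl, hk⟩
  refine le_sInf ?_
  rintro _ ⟨m, rfl, hm⟩
  exact_mod_cast h k m hk hm

/-- The map `j_m` sends an `(m+1)`-fold product of cocycles in `ker φ` to a coboundary. -/
theorem SecatPackage.j_prod_mem_range {m : ℕ} (S : SecatPackage DA DB φ m)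
    {n : Fin (m + 1) → ℕ} {b : Fin (m + 1) → A} (hb : ∀ i, b i ∈ cocycles DA (n i))
    (hφb : ∀ i, φ (b i) = 0) : S.j (List.ofFn b).prod ∈ LinearMap.range S.F.diff.d := by
  set w : S.T.carrier := (List.ofFn fun i => S.incl i (b i)).prod with hw
  have hw_cocycle : w ∈ cocycles S.T.diff (List.ofFn n).sum :=
    prod_ofFn_mem_cocycles S.T.diff fun i => (S.T_power.2.1 i).map_cocycles (hb i)
  have hw_ker : w ∈ LinearMap.ker S.p.toLinearMap := by
    rw [S.p_ker]
    exact prod_ofFn_mem_prod_ofFn fun i => Submodule.mem_map_of_mem (hφb i)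
  have hψ : S.ψ (S.i w) = 0 := by
    rw [← AlgHom.comp_apply, S.ψ_i]
    exact hw_ker
  have hi : S.i w ∈ LinearMap.range S.E.diff.d :=
    (inducedH_injective_iff S.ψ_dga _).1 (S.ψ_qiso _).1 _ (S.i_dga.map_cocycles hw_cocycle)
      (by rw [hψ]; exact Submodule.zero_mem _)
  have hmul : S.mul w = (List.ofFn b).prod := by
    rw [hw, map_list_prod, List.map_ofFn]
    congr 2
    funext i
    exact DFunLike.congr_fun (S.mul_incl i) (b i)
  rw [← hmul, ← AlgHom.comp_apply, ← S.square]
  exact S.bar_dga.map_range hi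

theorem nilKerH_le_Hsecat [GradedAlgebra 𝒜] [GradedAlgebra ℬ] (hφ : IsDGAHom DA DB φ)
    (hsurj : Function.Surjective φ) (S : ∀ m : ℕ, SecatPackage DA DB φ m) :
    nilKerH DA DB φ ≤ Hsecat S := by
  refine greatestNat_le_leastNat ?_
  rintro k m ⟨n, a, ha, hφa, hprod⟩ hinj
  by_contra! hmk
  obtain ⟨l, rfl⟩ : ∃ l, k = m + 1 + l := Nat.exists_eq_add_of_le hmk
  apply hprod
  rw [List.ofFn_add, List.prod_append]
  refine mul_mem_range_of_left DA ?_ (prod_ofFn_mem_cocycles DA fun i => ha _)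
  choose b hb hφb hab using fun i => exists_cocycle_mem_ker hφ hsurj (ha i) (hφa i)
  have hbrange := (inducedH_injective_iff (S m).j_dga _).1 (hinj _) _
    (prod_ofFn_mem_cocycles DA fun i : Fin (m + 1) => hb (Fin.castAdd l i))
    ((S m).j_prod_mem_range (fun i => hb _) fun i => hφb _)
  have hsub := prod_ofFn_sub_prod_ofFn_mem_range DA
    (fun i : Fin (m + 1) => ha (Fin.castAdd l i)) (fun i => hb _) fun i => hab _
  exact (Submodule.sub_mem_iff_left _ hbrange).1 hsub

theorem Hsecat_le_msecat (S : ∀ m : ℕ, SecatPackage DA DB φ m) : Hsecat S ≤ msecat S := by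
  refine leastNat_le_leastNat ?_
  rintro m ⟨ret, -, hd, -, hj⟩ i
  refine (inducedH_injective_iff (S m).j_dga i).2 ?_
  rintro x - ⟨c, hc⟩
  exact ⟨ret c, by rw [← hd, hc, hj]⟩

theorem msecat_le_secat (S : ∀ m : ℕ, SecatPackage DA DB φ m) : msecat S ≤ secat S := by
  refine leastNat_le_leastNat ?_
  rintro m ⟨ret, hret, hj⟩
  have hj' : ∀ a, ret ((S m).j a) = a := DFunLike.congr_fun hj
  refine ⟨ret.toLinearMap, hret.map_degree, hret.comm_d, fun a x => ?_, hj'⟩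
  change ret ((S m).j a * x) = a * ret x
  rw [map_mul, hj']

end SectionalCategory


/-- for a surjective morphism `φ` of cdgas in `CDGA_r(R)`
whose homology satisfies (★),
`nil ker(H(φ)) ≤ Hsecat(φ) ≤ msecat(φ) ≤ secat(φ)`. -/
theorem nilKerH_le_Hsecat_le_msecat_le_secat
    {R : Type u} [CommRing R] [IsDomain R] [IsPrincipalIdealRing R]
    (h2 : IsUnit (2 : R)) (r : ℕ)
    {A : Type u} [Ring A] [Algebra R A] {𝒜 : ℕ → Submodule R A} [GradedAlgebra 𝒜]
    {B : Type u} [Ring B] [Algebra R B] {ℬ : ℕ → Submodule R B} [GradedAlgebra ℬ]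
    (DA : Differential R 𝒜) (DB : Differential R ℬ)
    (hAc : GradedComm 𝒜) (hBc : GradedComm ℬ)
    (hAmild : IsHMild DA r ((r : ℕ∞) * rhoPID R))
    (hBmild : IsHMild DB r ((r : ℕ∞) * rhoPID R))
    (hAstar : StarCondition DA r) (hBstar : StarCondition DB r)
    (φ : A →ₐ[R] B) (hφ : IsDGAHom DA DB φ) (hsurj : Function.Surjective φ)
    (S : ∀ m : ℕ, SecatPackage DA DB φ m) :
    nilKerH DA DB φ ≤ Hsecat S ∧ Hsecat S ≤ msecat S ∧ msecat S ≤ secat S := by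
  exact ⟨nilKerH_le_Hsecat hφ hsurj S, Hsecat_le_msecat S, msecat_le_secat S⟩


end MildTC
end

section
/- Let φ:(A,d)→(B,d) be a surjective morphism of cdgas in CDGA_r(R) whose homology satisfies condition (★). Then secat(φ) ≤ nil ker(φ), where nil ker(φ) is the length of the longest non-trivial product of elements of the ideal ker(φ). -/
/-!
Common framework: graded differential algebras over a commutative ring `R`,
their cohomology, quasi-isomorphisms, free (product) and free commutative
extensions (relative free models `A ⊔ TV` and relative commutative models
`A ⊗ ΛV`), minimality, H-mildness, and the packages of data used to define
`secat`, `sc` and their variants following Benzaki–Rami.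
-/

namespace MildTC

universe u

section Components

open DirectSum

variable {R : Type u} [CommRing R]
variable {A : Type u} [Ring A] [Algebra R A] {𝒜 : ℕ → Submodule R A}
variable {B : Type u} [Ring B] [Algebra R B] {ℬ : ℕ → Submodule R B}

theorem Differential.d_one (D : Differential R 𝒜) [SetLike.GradedMonoid 𝒜] : D.d 1 = 0 := by
  have h := D.leibniz 0 0 1 SetLike.GradedOne.one_mem 1 SetLike.GradedOne.one_mem
  simpa using h

theorem decompose_map_of_map_degree [GradedAlgebra 𝒜] [GradedAlgebra ℬ] (f : A →ₗ[R] B)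
    (hf : ∀ i : ℕ, ∀ a ∈ 𝒜 i, f a ∈ ℬ i) (n : ℕ) (a : A) :
    (decompose ℬ (f a) n : B) = f (decompose 𝒜 a n) := by
  induction a using Decomposition.inductionOn 𝒜 with
  | zero => simp
  | @homogeneous i m =>
    rw [decompose_of_mem ℬ (hf i m m.2), decompose_coe, coe_of_apply, coe_of_apply]
    split_ifs <;> simp
  | add a b ha hb => simp [decompose_add, ha, hb]

/-- The elements whose homogeneous components lie in the submodules `T n`. -/
def componentSubalgebra (𝒜 : ℕ → Submodule R A) [GradedAlgebra 𝒜] (T : ℕ → Submodule R A)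
    [SetLike.GradedMonoid T] (hT : ∀ n, T n ≤ 𝒜 n) : Subalgebra R A where
  carrier := {x | ∀ n, (decompose 𝒜 x n : A) ∈ T n}
  add_mem' {x y} hx hy n := by
    simpa [decompose_add] using add_mem (hx n) (hy n)
  mul_mem' {x y} hx hy n := by
    rw [decompose_mul, coe_mul_apply_eq_sum_antidiagonal]
    refine sum_mem fun ij hij => ?_
    rw [← Finset.HasAntidiagonal.mem_antidiagonal.1 hij]
    exact SetLike.GradedMul.mul_mem (hx _) (hy _)
  algebraMap_mem' r n := by
    have h1 : algebraMap R A r ∈ T 0 := by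
      rw [Algebra.algebraMap_eq_smul_one]
      exact (T 0).smul_mem r SetLike.GradedOne.one_mem
    rw [decompose_of_mem 𝒜 (hT 0 h1), coe_of_apply]
    split_ifs with h
    · subst h; exact h1
    · exact zero_mem _

section

variable [GradedAlgebra 𝒜] (T : ℕ → Submodule R A) [SetLike.GradedMonoid T]
  (hT : ∀ n, T n ≤ 𝒜 n)

theorem le_componentSubalgebra (n : ℕ) {x : A} (hx : x ∈ T n) :
    x ∈ componentSubalgebra 𝒜 T hT := by
  intro k
  rw [decompose_of_mem 𝒜 (hT n hx), coe_of_apply]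
  split_ifs with h
  · subst h; exact hx
  · exact zero_mem _

/-- The grading of `componentSubalgebra` induced by the ambient one. -/
def componentGrading (n : ℕ) : Submodule R (componentSubalgebra 𝒜 T hT) :=
  (𝒜 n).comap (componentSubalgebra 𝒜 T hT).val.toLinearMap

theorem componentGrading_isInternal : IsInternal (componentGrading T hT) := by
  classical
  constructor
  · intro x y hxy
    have key : ∀ (z : ⨁ n, componentGrading T hT n) (n : ℕ),
        ((decompose 𝒜 ((DirectSum.coeAddMonoidHom (componentGrading T hT) z :
          componentSubalgebra 𝒜 T hT) : A) n : 𝒜 n) : A)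
          = ((z n : componentSubalgebra 𝒜 T hT) : A) := by
      intro z n
      induction z using DirectSum.induction_on with
      | zero => simp
      | of i w =>
        have hw : ((w : componentSubalgebra 𝒜 T hT) : A) ∈ 𝒜 i := w.2
        rw [coeAddMonoidHom_of, decompose_of_mem 𝒜 hw, coe_of_apply, coe_of_apply]
        split_ifs <;> simp
      | add a b ha hb => simp [decompose_add, ha, hb]
    refine DFinsupp.ext fun n => Subtype.ext (Subtype.ext ?_)
    rw [← key x n, ← key y n, hxy]
  · intro x
    refine ⟨∑ i ∈ (decompose 𝒜 (x : A)).support,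
      DirectSum.of (fun n => componentGrading T hT n) i
        ⟨⟨decompose 𝒜 (x : A) i, le_componentSubalgebra T hT i (x.2 i)⟩,
          (decompose 𝒜 (x : A) i).2⟩, Subtype.ext ?_⟩
    simp only [map_sum, coeAddMonoidHom_of]
    rw [AddSubmonoidClass.coe_finsetSum]
    exact sum_support_decompose 𝒜 (x : A)

noncomputable instance : GradedAlgebra (componentGrading T hT) where
  toDecomposition := (componentGrading_isInternal T hT).chooseDecomposition
  one_mem := (SetLike.GradedOne.one_mem : (1 : A) ∈ 𝒜 0)
  mul_mem _ _ _ _ hx hy := SetLike.GradedMul.mul_mem (A := 𝒜) hx hy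

theorem d_mem_componentSubalgebra (D : Differential R 𝒜)
    (hd : ∀ n, ∀ x ∈ T n, D.d x ∈ T (n + 1)) {x : A} (hx : x ∈ componentSubalgebra 𝒜 T hT) :
    D.d x ∈ componentSubalgebra 𝒜 T hT := by
  classical
  rw [← sum_support_decompose 𝒜 x, map_sum]
  exact sum_mem fun i _ => le_componentSubalgebra T hT (i + 1) (hd i _ (hx i))

/-- `componentSubalgebra` as a sub-dga. -/
noncomputable def componentDGA (D : Differential R 𝒜)
    (hd : ∀ n, ∀ x ∈ T n, D.d x ∈ T (n + 1)) : GradedDGA R where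
  carrier := componentSubalgebra 𝒜 T hT
  grading := componentGrading T hT
  diff :=
    { d := D.d.restrict (p := (componentSubalgebra 𝒜 T hT).toSubmodule)
        (q := (componentSubalgebra 𝒜 T hT).toSubmodule)
        fun _ hx => d_mem_componentSubalgebra T hT D hd hx
      d_squared := fun a => Subtype.ext (D.d_squared a)
      d_degree := fun i a ha => D.d_degree i a ha
      leibniz := fun i j a ha b hb => Subtype.ext (D.leibniz i j a ha b hb) }

theorem gradedComm_componentGrading (hc : GradedComm 𝒜) :
    GradedComm (componentGrading T hT) :=
  fun i j a ha b hb => Subtype.ext (hc i j a ha b hb)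

end

section HomLocus

variable (DA : Differential R 𝒜) (DB : Differential R ℬ) (h : A →ₐ[R] B)

/-- The degree `n` elements on which `h` preserves the degree and commutes with `d`. -/
def homLocus (n : ℕ) : Submodule R A :=
  𝒜 n ⊓ (ℬ n).comap h.toLinearMap ⊓
    LinearMap.eqLocus (h.toLinearMap ∘ₗ DA.d) (DB.d ∘ₗ h.toLinearMap)

variable {DA DB h}

theorem mem_homLocus {n : ℕ} {x : A} :
    x ∈ homLocus DA DB h n ↔ x ∈ 𝒜 n ∧ h x ∈ ℬ n ∧ h (DA.d x) = DB.d (h x) := by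
  simp [homLocus, and_assoc]

variable (DA DB h)

theorem homLocus_le (n : ℕ) : homLocus DA DB h n ≤ 𝒜 n := fun _ hx => (mem_homLocus.1 hx).1

theorem d_mem_homLocus (n : ℕ) (x : A) (hx : x ∈ homLocus DA DB h n) :
    DA.d x ∈ homLocus DA DB h (n + 1) := by
  obtain ⟨h1, h2, h3⟩ := mem_homLocus.1 hx
  refine mem_homLocus.2 ⟨DA.d_degree n x h1, ?_, ?_⟩
  · rw [h3]; exact DB.d_degree n _ h2
  · rw [DA.d_squared, h3, DB.d_squared, map_zero]

instance [GradedAlgebra 𝒜] [GradedAlgebra ℬ] : SetLike.GradedMonoid (homLocus DA DB h) where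
  one_mem := mem_homLocus.2 ⟨SetLike.GradedOne.one_mem, by
    rw [map_one]; exact SetLike.GradedOne.one_mem, by
    rw [DA.d_one, map_one h, DB.d_one, map_zero]⟩
  mul_mem i j x y hx hy := by
    obtain ⟨x1, x2, x3⟩ := mem_homLocus.1 hx
    obtain ⟨y1, y2, y3⟩ := mem_homLocus.1 hy
    refine mem_homLocus.2 ⟨SetLike.GradedMul.mul_mem x1 y1, ?_, ?_⟩
    · rw [map_mul]; exact SetLike.GradedMul.mul_mem x2 y2
    · rw [DA.leibniz i j x x1 y y1, map_mul, DB.leibniz i j _ x2 _ y2, map_add, map_zsmul,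
        map_mul, map_mul, x3, y3]

/-- A map `f` into the source of `h` factors through the locus where `h` is a dga morphism
as soon as `f` and `h ∘ f` are dga morphisms. -/
theorem map_mem_homLocus {C : Type u} [Ring C] [Algebra R C] {𝒞 : ℕ → Submodule R C}
    {DC : Differential R 𝒞} {f : C →ₐ[R] A} (hf : IsDGAHom DC DA f)
    (hhf : IsDGAHom DC DB (h.comp f)) {n : ℕ} {c : C} (hc : c ∈ 𝒞 n) :
    f c ∈ homLocus DA DB h n :=
  mem_homLocus.2 ⟨hf.map_degree n c hc, hhf.map_degree n c hc, by
    rw [← hf.comm_d]; exact hhf.comm_d c⟩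

theorem isDGAHom_of_decompose_mem_homLocus [GradedAlgebra 𝒜]
    (hx : ∀ (x : A) (n : ℕ), (decompose 𝒜 x n : A) ∈ homLocus DA DB h n) :
    IsDGAHom DA DB h where
  map_degree n a ha := by
    have := (mem_homLocus.1 (hx a n)).2.1
    rwa [decompose_of_mem_same 𝒜 ha] at this
  comm_d a := by
    classical
    rw [← sum_support_decompose 𝒜 a]
    simp only [map_sum]
    exact Finset.sum_congr rfl fun i _ => (mem_homLocus.1 (hx a i)).2.2

end HomLocus

end Components

section Pushout

open DirectSum

variable {R : Type u} [CommRing R]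
variable {A : Type u} [Ring A] [Algebra R A] {𝒜 : ℕ → Submodule R A}
variable {B : Type u} [Ring B] [Algebra R B] {ℬ : ℕ → Submodule R B}

theorem SecatPackage.isDGAHom_of_comp [GradedAlgebra 𝒜] {DA : Differential R 𝒜} {DB : Differential R ℬ}
    {φ : A →ₐ[R] B} {m : ℕ} (S : SecatPackage DA DB φ m) (C : GradedDGA R)
    (h : S.F.carrier →ₐ[R] C.carrier) (hbar : IsDGAHom S.E.diff C.diff (h.comp S.bar))
    (hj : IsDGAHom DA C.diff (h.comp S.j)) : IsDGAHom S.F.diff C.diff h := by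
  let T := homLocus S.F.diff C.diff h
  have hT : ∀ n, T n ≤ S.F.grading n := homLocus_le _ _ _
  let K := componentDGA T hT S.F.diff (d_mem_homLocus _ _ _)
  let L := componentSubalgebra S.F.grading T hT
  have hK : GradedComm K.grading := gradedComm_componentGrading T hT S.Fcomm
  have memE (e : S.E.carrier) : S.bar e ∈ L := fun n => by
    rw [← AlgHom.toLinearMap_apply S.bar e,
      decompose_map_of_map_degree (𝒜 := S.E.grading) _ S.bar_dga.map_degree]
    exact map_mem_homLocus _ _ _ S.bar_dga hbar (SetLike.coe_mem _)
  have memA (a : A) : S.j a ∈ L := fun n => by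
    rw [← AlgHom.toLinearMap_apply S.j a,
      decompose_map_of_map_degree (𝒜 := 𝒜) _ S.j_dga.map_degree]
    exact map_mem_homLocus _ _ _ S.j_dga hj (SetLike.coe_mem _)
  have dgaE : IsDGAHom S.E.diff K.diff (S.bar.codRestrict L memE) :=
    ⟨S.bar_dga.map_degree, fun e => Subtype.ext (S.bar_dga.comm_d e)⟩
  have dgaA : IsDGAHom DA K.diff (S.j.codRestrict L memA) :=
    ⟨S.j_dga.map_degree, fun a => Subtype.ext (S.j_dga.comm_d a)⟩
  obtain ⟨k, ⟨k1, k2⟩, -⟩ : ∃! k : S.F.carrier →ₐ[R] L,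
      k.comp S.bar = S.bar.codRestrict L memE ∧ k.comp S.j = S.j.codRestrict L memA :=
    S.pushout K hK _ dgaE _ dgaA
      (AlgHom.ext fun t => Subtype.ext (DFunLike.congr_fun S.square t))
  have hid : L.val.comp k = AlgHom.id R S.F.carrier := by
    refine (S.pushout S.F S.Fcomm S.bar S.bar_dga S.j S.j_dga S.square).unique
      ⟨?_, ?_⟩ ⟨rfl, rfl⟩
    · rw [AlgHom.comp_assoc]
      exact congrArg (fun f => L.val.comp f) k1
    · rw [AlgHom.comp_assoc]
      exact congrArg (fun f => L.val.comp f) k2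
  refine isDGAHom_of_decompose_mem_homLocus _ _ _ fun x => ?_
  have hx : ((k x : L) : S.F.carrier) = x := DFunLike.congr_fun hid x
  have hmem : x ∈ L := hx ▸ (k x : L).2
  exact hmem

/-- If all products of `m + 1` elements of `ker φ` vanish, then `μ_{m+1}` kills
`(ker φ)^{⊗(m+1)}`. -/
theorem SecatPackage.ker_p_le_ker_mul {DA : Differential R 𝒜} {DB : Differential R ℬ}
    {φ : A →ₐ[R] B} {m : ℕ} (S : SecatPackage DA DB φ m)
    (hnil : ∀ a : Fin (m + 1) → A, (∀ i, φ (a i) = 0) → (List.ofFn a).prod = 0) :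
    LinearMap.ker S.p.toLinearMap ≤ LinearMap.ker S.mul.toLinearMap := by
  have hK : LinearMap.ker φ.toLinearMap ^ (m + 1) = ⊥ := by
    rw [Submodule.pow_eq_span_pow_set, Submodule.span_eq_bot]
    intro x hx
    obtain ⟨f, rfl⟩ := Set.mem_pow.1 hx
    exact hnil _ fun i => (f i).2
  have hmap : (Submodule.mapHom S.mul) (LinearMap.ker S.p.toLinearMap) = ⊥ := by
    rw [S.p_ker, map_list_prod, List.map_ofFn, ← hK, ← List.prod_replicate, ← List.ofFn_const]
    congr 2
    funext j
    change Submodule.map S.mul.toLinearMap (Submodule.map (S.incl j).toLinearMap _) = _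
    rw [← Submodule.map_comp, ← AlgHom.comp_toLinearMap, S.mul_incl j]
    exact Submodule.map_id _
  exact fun x hx => (Submodule.mem_bot R).1 (hmap ▸ Submodule.mem_map_of_mem hx)

theorem SecatPackage.exists_retraction [GradedAlgebra 𝒜] {DA : Differential R 𝒜} {DB : Differential R ℬ}
    {φ : A →ₐ[R] B} {m : ℕ} (hAc : GradedComm 𝒜) (S : SecatPackage DA DB φ m)
    (hker : LinearMap.ker S.p.toLinearMap ≤ LinearMap.ker S.mul.toLinearMap) :
    ∃ ret : S.F.carrier →ₐ[R] A,
      IsDGAHom S.F.diff DA ret ∧ ret.comp S.j = AlgHom.id R A := by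
  have hval (s t : S.T.carrier) (hst : S.p s = S.p t) : S.mul s = S.mul t := by
    have : s - t ∈ LinearMap.ker S.p.toLinearMap := by simp [hst]
    simpa [sub_eq_zero] using hker this
  choose σ hσ using S.p_surj
  let ν : S.Q.carrier →ₐ[R] A := AlgHom.ofLinearMap
    { toFun := fun q => S.mul (σ q)
      map_add' := fun x y => by rw [← map_add]; exact hval _ _ (by simp [hσ])
      map_smul' := fun r x => by
        rw [RingHom.id_apply, ← map_smul]; exact hval _ _ (by simp [hσ]) }
    ((hval _ 1 (by simp [hσ])).trans (map_one _))
    (fun x y => (hval _ (σ x * σ y) (by simp [hσ])).trans (map_mul _ _ _))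
  have hν (t : S.T.carrier) : ν (S.p t) = S.mul t := hval _ _ (hσ _)
  have ν_dga : IsDGAHom S.Q.diff DA ν := by
    constructor
    · intro n q hq
      obtain ⟨t, rfl⟩ := S.p_surj q
      have h1 := decompose_map_of_map_degree (𝒜 := S.T.grading) S.p.toLinearMap
        S.p_dga.map_degree n t
      rw [AlgHom.toLinearMap_apply, decompose_of_mem_same _ hq, AlgHom.toLinearMap_apply] at h1
      rw [h1, hν]
      exact S.mul_dga.map_degree n _ (SetLike.coe_mem _)
    · intro q
      obtain ⟨t, rfl⟩ := S.p_surj q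
      rw [← S.p_dga.comm_d, hν, hν, S.mul_dga.comm_d]
  let C : GradedDGA R := { carrier := A, grading := 𝒜, diff := DA }
  have τ_dga : IsDGAHom S.E.diff DA (ν.comp S.ψ) :=
    ⟨fun n e he => ν_dga.map_degree n _ (S.ψ_dga.map_degree n e he), fun e => by
      rw [AlgHom.comp_apply, S.ψ_dga.comm_d, ν_dga.comm_d, AlgHom.comp_apply]⟩
  have id_dga : IsDGAHom DA DA (AlgHom.id R A) := ⟨fun _ _ ha => ha, fun _ => rfl⟩
  obtain ⟨h, ⟨h1, h2⟩, -⟩ := S.pushout C hAc (ν.comp S.ψ) τ_dga (AlgHom.id R A) id_dga (by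
    rw [AlgHom.comp_assoc, S.ψ_i]
    exact AlgHom.ext hν)
  exact ⟨h, S.isDGAHom_of_comp C h (h1 ▸ τ_dga) (h2 ▸ id_dga), h2⟩

end Pushout

/-- Corollary 4.3: for a surjective morphism `φ` of cdgas in
`CDGA_r(R)` whose homology satisfies (★), `secat(φ) ≤ nil ker(φ)`. -/
theorem secat_le_nilKer
    {R : Type u} [CommRing R] [IsDomain R] [IsPrincipalIdealRing R]
    (h2 : IsUnit (2 : R)) (r : ℕ)
    {A : Type u} [Ring A] [Algebra R A] {𝒜 : ℕ → Submodule R A} [GradedAlgebra 𝒜]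
    {B : Type u} [Ring B] [Algebra R B] {ℬ : ℕ → Submodule R B} [GradedAlgebra ℬ]
    (DA : Differential R 𝒜) (DB : Differential R ℬ)
    (hAc : GradedComm 𝒜) (hBc : GradedComm ℬ)
    (hAmild : IsHMild DA r ((r : ℕ∞) * rhoPID R))
    (hBmild : IsHMild DB r ((r : ℕ∞) * rhoPID R))
    (hAstar : StarCondition DA r) (hBstar : StarCondition DB r)
    (φ : A →ₐ[R] B) (hφ : IsDGAHom DA DB φ) (hsurj : Function.Surjective φ)
    (S : ∀ m : ℕ, SecatPackage DA DB φ m) :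
    secat S ≤ nilKerAlg φ := by
  generalize hN : nilKerAlg φ = N
  induction N using ENat.recTopCoe with
  | top => exact le_top
  | coe m =>
    refine sInf_le ⟨m, rfl, (S m).exists_retraction hAc ((S m).ker_p_le_ker_mul fun a ha => ?_)⟩
    by_contra hne
    have hle : ((m + 1 : ℕ) : ℕ∞) ≤ nilKerAlg φ := le_sSup ⟨m + 1, rfl, a, ha, hne⟩
    rw [hN, Nat.cast_le] at hle
    omega


end MildTC
end
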